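/- Let H ⊂ C_∞ be an A-lattice of rank r, i.e. a strongly discrete A-submodule of C_∞ that is free of rank r over A = 𝔽_q[t]. Then for every nonzero a ∈ A there exists a unique 𝔽_q-linear polynomial φ^H_a(X) = ∑_{i=0}^{r·deg(a)} c_i X^{q^i} ∈ C_∞[X] of degree |a|^r = q^{r·deg(a)} satisfying φ^H_a(e_H(z)) = e_H(az) for all z ∈ C_∞; moreover c_0 = a, and the map a ↦ φ^H_a satisfies φ^H_{a+b} = φ^H_a + φ^H_b and φ^H_{ab} = φ^H_a ∘ φ^H_b for all nonzero a, b ∈ A (i.e. φ^H is a Drinfeld A-module of rank r). -/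

import Mathlib

noncomputable section

namespace Paper

/-- A subgroup `H` of `(K,+)` is strongly discrete if its intersection with every ball of
finite radius is finite. -/
def StronglyDiscrete {K : Type*} [NormedField K] (H : AddSubgroup K) : Prop :=
  ∀ ρ : ℝ, 0 < ρ → {z : K | z ∈ H ∧ ‖z‖ ≤ ρ}.Finite

/-- The exponential function `e_H(z) = z·∏_{h ∈ H∖{0}} (1 − z/h)` associated to a strongly
discrete subgroup `H ⊂ K`. -/
noncomputable def eH {K : Type*} [NormedField K] (H : AddSubgroup K) (z : K) : K :=
  z * ∏' h : {x : K // x ∈ H ∧ x ≠ 0}, (1 - z / h.1)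


open Filter Topology

section Aux

set_option linter.unusedSectionVars false

variable {K : Type*} [NormedField K]

lemma norm_prod_sub_one_le [IsUltrametricDist K] {ι : Type*} (f : ι → K) (δ : ℝ) (h0 : 0 ≤ δ)
    (h1 : δ ≤ 1) (T : Finset ι) (h : ∀ i ∈ T, ‖f i - 1‖ ≤ δ) : ‖∏ i ∈ T, f i - 1‖ ≤ δ := by
  classical
  induction T using Finset.induction_on with
  | empty => simpa using h0
  | insert a s ha ih =>
    rw [Finset.prod_insert ha]
    have e1 := ih (fun i hi => h i (Finset.mem_insert_of_mem hi))
    have e2 := h a (Finset.mem_insert_self _ _)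
    set P := ∏ i ∈ s, f i
    have : f a * P - 1 = ((f a - 1) * (P - 1) + (f a - 1)) + (P - 1) := by ring
    rw [this]
    refine (IsUltrametricDist.norm_add_le_max _ _).trans (max_le ?_ e1)
    refine (IsUltrametricDist.norm_add_le_max _ _).trans (max_le ?_ e2)
    rw [norm_mul]
    calc _ ≤ δ * 1 := mul_le_mul e2 (e1.trans h1) (norm_nonneg _) h0
      _ = δ := mul_one _

lemma multipliable_of_tendsto [CompleteSpace K] [IsUltrametricDist K] {ι : Type*} (f : ι → K)
    (hf : Tendsto f cofinite (𝓝 1)) : Multipliable f := by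
  classical
  have hfin : ∀ δ : ℝ, 0 < δ → {i | ¬ ‖f i - 1‖ ≤ δ}.Finite := by
    intro δ hδ
    have := (Metric.tendsto_nhds.1 hf) δ hδ
    rw [Filter.eventually_cofinite] at this
    refine this.subset fun i hi hlt => hi ?_
    rw [dist_eq_norm] at hlt
    exact hlt.le
  have hc : CauchySeq (fun s : Finset ι => ∏ i ∈ s, f i) := by
    rw [Metric.cauchySeq_iff']
    intro ε hε
    set S0 := (hfin 1 one_pos).toFinset
    set M := ‖∏ i ∈ S0, f i‖
    have hM : 0 ≤ M := norm_nonneg _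
    set δ := min 1 (ε / (M + 1))
    have hδ : 0 < δ := lt_min one_pos (by positivity)
    refine ⟨S0 ∪ (hfin δ hδ).toFinset, fun n hn => ?_⟩
    set N := S0 ∪ (hfin δ hδ).toFinset
    have e1 : ∏ i ∈ n, f i = (∏ i ∈ n \ N, f i) * ∏ i ∈ N, f i :=
      (Finset.prod_sdiff hn).symm
    have e2 : ‖∏ i ∈ N, f i‖ ≤ M := by
      rw [← Finset.prod_sdiff (Finset.subset_union_left : S0 ⊆ N), norm_mul, norm_prod]
      refine mul_le_of_le_one_left hM (Finset.prod_le_one (fun _ _ => norm_nonneg _) ?_)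
      intro i hi
      have : ‖f i - 1‖ ≤ 1 := by
        by_contra hh
        exact (Finset.mem_sdiff.1 hi).2 (by simpa [S0] using hh)
      calc ‖f i‖ = ‖(f i - 1) + 1‖ := by ring_nf
        _ ≤ max ‖f i - 1‖ ‖(1:K)‖ := IsUltrametricDist.norm_add_le_max _ _
        _ ≤ 1 := max_le this (by simp)
    have e3 : ‖∏ i ∈ n \ N, f i - 1‖ ≤ δ := by
      refine norm_prod_sub_one_le f δ hδ.le (min_le_left _ _) _ fun i hi => ?_
      by_contra hh
      exact (Finset.mem_sdiff.1 hi).2 (Finset.mem_union_right _ (by simpa using hh))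
    rw [dist_eq_norm, e1, ← sub_one_mul, norm_mul]
    calc _ ≤ δ * M := mul_le_mul e3 e2 (norm_nonneg _) hδ.le
      _ ≤ ε / (M + 1) * M := by gcongr; exact min_le_right _ _
      _ < ε := by
        rw [div_mul_eq_mul_div, div_lt_iff₀ (by positivity)]
        nlinarith
  exact cauchySeq_tendsto_of_complete hc

/-- normalising factor -/
def kap (h : K) : K := open Classical in if h = 0 then 1 else h⁻¹

/-- factors of the exponential -/
def uu (z h : K) : K := (z + h) * kap h

lemma kap_ne (h : K) : kap h ≠ 0 := by
  unfold kap; split_ifs <;> simp_all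

lemma uu_zero (z : K) : uu z 0 = z := by simp [uu, kap]

lemma uu_ne {z h : K} (hh : h ≠ 0) : uu z h = 1 + z / h := by
  simp [uu, kap, hh]; field_simp; ring

lemma tendsto_norm {H : AddSubgroup K} (hH : StronglyDiscrete H) :
    Tendsto (fun h : H => ‖(h : K)‖) cofinite atTop := by
  rw [tendsto_atTop]
  intro b
  rw [eventually_cofinite]
  have := hH (max b 1) (by positivity)
  refine Set.Finite.of_finite_image (f := Subtype.val) (this.subset ?_) Subtype.val_injective.injOn
  rintro _ ⟨x, hx, rfl⟩
  exact ⟨x.2, le_max_of_le_left (not_le.1 hx).le⟩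

lemma tendsto_inv {H : AddSubgroup K} (hH : StronglyDiscrete H) (c : K) :
    Tendsto (fun h : H => ((h : K) + c)⁻¹) cofinite (𝓝 0) := by
  have h1 : Tendsto (fun h : H => ‖(h : K) + c‖) cofinite atTop := by
    refine tendsto_atTop_mono (fun h => ?_) (tendsto_atTop_add_const_right _ (-‖c‖) (tendsto_norm hH))
    have := norm_sub_le ((h:K) + c) c
    simp only [add_sub_cancel_right] at this
    linarith
  rw [tendsto_zero_iff_norm_tendsto_zero]
  simp only [norm_inv]
  exact tendsto_inv_atTop_zero.comp h1

lemma tendsto_uu {H : AddSubgroup K} (hH : StronglyDiscrete H) (z : K) :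
    Tendsto (fun h : H => uu z (h : K)) cofinite (𝓝 1) := by
  have h1 : Tendsto (fun h : H => 1 + z * ((h : K) + 0)⁻¹) cofinite (𝓝 1) := by
    simpa using ((tendsto_inv hH 0).const_mul z).const_add 1
  refine h1.congr' ?_
  have : ∀ᶠ h : H in cofinite, h ≠ 0 := by
    rw [eventually_cofinite]; simp
  filter_upwards [this] with h hh
  rw [uu_ne (by simpa using hh), add_zero, div_eq_mul_inv]

variable [CompleteSpace K] [IsUltrametricDist K]

lemma mult_uu {H : AddSubgroup K} (hH : StronglyDiscrete H) (z : K) :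
    Multipliable (fun h : H => uu z (h : K)) := multipliable_of_tendsto _ (tendsto_uu hH z)

lemma eH_eq {H : AddSubgroup K} (hH : StronglyDiscrete H) (z : K) :
    eH H z = ∏' h : H, uu z (h : K) := by
  classical
  -- reindex over nonzero h
  let e : {x : K // x ∈ H ∧ x ≠ 0} ≃ {h : H // h ≠ 0} :=
    { toFun := fun x => ⟨⟨-x.1, H.neg_mem x.2.1⟩, fun h0 => x.2.2 (by simpa using congrArg (fun y : H => (y : K)) h0)⟩
      invFun := fun h => ⟨-h.1.1, H.neg_mem h.1.2, fun h0 => h.2 (Subtype.ext (by simpa using h0))⟩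
      left_inv := fun x => by simp
      right_inv := fun x => by simp }
  have hm : Multipliable (fun h : {h : H // h ≠ 0} => uu z (h.1 : K)) :=
    multipliable_of_tendsto _ ((tendsto_uu hH z).comp Subtype.val_injective.tendsto_cofinite)
  have h1 : ∏' h : {x : K // x ∈ H ∧ x ≠ 0}, (1 - z / h.1) =
      ∏' h : {h : H // h ≠ 0}, uu z (h.1 : K) := by
    rw [← e.tprod_eq]
    refine tprod_congr fun x => ?_
    rw [uu_ne (by simpa [e] using x.2.2)]
    simp [e, div_neg, sub_eq_add_neg]
  unfold eH
  rw [h1]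
  have h2 : HasProd (fun h : H => uu z (h : K))
      (uu z ((0 : H) : K) * ∏' h : {h : H // h ≠ 0}, uu z (h.1 : K)) := by
    have a1 : HasProd ((fun h : H => uu z (h : K)) ∘ (Subtype.val : ({0} : Set H) → H))
        (uu z ((0 : H) : K)) := by
      have := hasProd_unique ((fun h : H => uu z (h : K)) ∘ (Subtype.val : ({0} : Set H) → H))
      simpa using this
    exact a1.mul_compl (s := {0}) hm.hasProd
  rw [h2.tprod_eq]
  simp [uu_zero]

lemma eH_hasProd {H : AddSubgroup K} (hH : StronglyDiscrete H) (z : K) :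
    HasProd (fun h : H => uu z (h : K)) (eH H z) := by
  rw [eH_eq hH]; exact (mult_uu hH z).hasProd

lemma fin_add {H : AddSubgroup K} (S : Finset H) (h0 : (0 : H) ∈ S)
    (hadd : ∀ x ∈ S, ∀ y ∈ S, x + y ∈ S) (hneg : ∀ x ∈ S, -x ∈ S) (z w : K) :
    ∏ h ∈ S, (z + w + (h : K)) = ∏ h ∈ S, (z + (h : K)) + ∏ h ∈ S, (w + (h : K)) := by
  classical
  open Polynomial in
  let F : K[X] := ∏ h ∈ S, (X + C (h : K))
  have hF : ∀ x, F.eval x = ∏ h ∈ S, (x + (h : K)) := fun x => by simp [F, Polynomial.eval_prod]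
  have hFm : F.Monic := Polynomial.monic_prod_of_monic _ _ fun i _ => Polynomial.monic_X_add_C _
  have hFd : F.natDegree = S.card := by
    simp [F, Polynomial.natDegree_prod_of_monic _ _ fun (i : H) _ => Polynomial.monic_X_add_C (i : K)]
  have hpos : 0 < S.card := Finset.card_pos.2 ⟨0, h0⟩
  let G : Polynomial K := Polynomial.taylor w F - F - Polynomial.C (F.eval w)
  have hG0 : G = 0 := by
    by_contra hne
    have hdeg : (Polynomial.taylor w F - F).degree < F.degree := by
      have := Polynomial.degree_sub_lt_left (p := Polynomial.taylor w F) (q := F)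
        (by simp) (by simpa using hFm.ne_zero) (by simp)
      simpa using this
    have hFdeg : F.degree = S.card := by
      rw [Polynomial.degree_eq_natDegree hFm.ne_zero, hFd]
    have hGd : G.degree < S.card := by
      refine (Polynomial.degree_sub_le _ _).trans_lt (max_lt (hFdeg ▸ hdeg) ?_)
      exact Polynomial.degree_C_le.trans_lt (by exact_mod_cast hpos)
    refine hne (Polynomial.eq_zero_of_degree_lt_of_eval_finset_eq_zero (S.image (Subtype.val : H → K)) ?_ ?_)
    · rwa [Finset.card_image_of_injective _ Subtype.val_injective]
    · intro x hx
      obtain ⟨v, hv, rfl⟩ := Finset.mem_image.1 hx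
      have e1 : F.eval ((v : K) + w) = F.eval w := by
        rw [hF, hF]
        refine Finset.prod_bij' (fun h _ => v + h) (fun h _ => -v + h) ?_ ?_ ?_ ?_ ?_
        · exact fun h hh => hadd _ hv _ hh
        · exact fun h hh => hadd _ (hneg _ hv) _ hh
        · intros; simp
        · intros; simp
        · intros; push_cast; ring
      have e2 : F.eval (v : K) = 0 := by
        rw [hF]
        exact Finset.prod_eq_zero (hneg _ hv) (by simp)
      simp [G, Polynomial.taylor_eval, e1, e2]
  have := congrArg (Polynomial.eval z) hG0
  simp only [G, Polynomial.eval_sub, Polynomial.taylor_eval, Polynomial.eval_C, hF,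
    Polynomial.eval_zero] at this
  rw [← sub_eq_zero, ← this]; ring

lemma eH_add {H : AddSubgroup K} (hH : StronglyDiscrete H) (z w : K) :
    eH H (z + w) = eH H z + eH H w := by
  have hfin : ∀ n : ℕ, {h : H | ‖(h : K)‖ ≤ n + 1}.Finite := by
    intro n
    refine Set.Finite.of_finite_image (f := Subtype.val) ((hH (n + 1) (by positivity)).subset ?_)
      Subtype.val_injective.injOn
    rintro _ ⟨x, hx, rfl⟩
    exact ⟨x.2, hx⟩
  let S : ℕ → Finset H := fun n => (hfin n).toFinset
  have memS : ∀ n h, h ∈ S n ↔ ‖(h : K)‖ ≤ n + 1 := fun n h => by simp [S]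
  have hS : Tendsto S atTop atTop := by
    refine tendsto_atTop_finset_of_monotone ?_ ?_
    · intro m n hmn h hh
      rw [memS] at hh ⊢
      have : (m : ℝ) ≤ n := by exact_mod_cast hmn
      linarith
    · intro h
      obtain ⟨n, hn⟩ := exists_nat_ge ‖(h : K)‖
      exact ⟨n, (memS _ _).2 (by linarith)⟩
  have ht : ∀ z, Tendsto (fun n => ∏ h ∈ S n, uu z (h : K)) atTop (𝓝 (eH H z)) := by
    intro z
    have := eH_hasProd hH z
    rw [HasProd, SummationFilter.unconditional_filter] at this
    exact this.comp hS
  refine tendsto_nhds_unique (ht (z + w)) (((ht z).add (ht w)).congr fun n => ?_)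
  simp only [uu, Finset.prod_mul_distrib, ← add_mul]
  rw [fin_add (S n)]
  · rw [memS]; simp; positivity
  · intro x hx y hy
    rw [memS] at *
    exact (IsUltrametricDist.norm_add_le_max _ _).trans (max_le hx hy)
  · intro x hx
    rw [memS] at *
    simpa using hx

lemma eH_zero (H : AddSubgroup K) : eH H 0 = 0 := by simp [eH]

lemma eH_neg {H : AddSubgroup K} (hH : StronglyDiscrete H) (z : K) :
    eH H (-z) = - eH H z := by
  have := eH_add hH z (-z)
  rw [add_neg_cancel, eH_zero] at this
  linear_combination -this

lemma eH_ne_zero {H : AddSubgroup K} (hH : StronglyDiscrete H) {z : K} (hz : z ∉ H) :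
    eH H z ≠ 0 := by
  have hne : ∀ h : H, uu z (h : K) ≠ 0 := by
    intro h
    refine mul_ne_zero (fun h0 => hz ?_) (kap_ne _)
    rw [eq_neg_of_add_eq_zero_left h0]
    exact H.neg_mem h.2
  have h1 : Multipliable (fun h : H => (uu z (h : K))⁻¹) :=
    multipliable_of_tendsto _ (by simpa using (tendsto_uu hH z).inv₀ one_ne_zero)
  have h2 := (eH_hasProd hH z).mul h1.hasProd
  intro h0
  rw [h0, zero_mul] at h2
  have h3 : HasProd (fun h : H => uu z (h : K) * (uu z (h : K))⁻¹) 1 := by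
    have : (fun h : H => uu z (h : K) * (uu z (h : K))⁻¹) = fun _ => 1 := by
      funext h; exact mul_inv_cancel₀ (hne h)
    rw [this]; exact hasProd_one
  exact one_ne_zero (h3.unique h2)

/-- coset product -/
lemma eH_coset {H : AddSubgroup K} (hH : StronglyDiscrete H) {c : K} (hc : c ∉ H) (z : K) :
    HasProd (fun h : H => uu z (c + (h : K))) (1 + eH H z / eH H c) := by
  have hne : ∀ h : H, c + (h : K) ≠ 0 := by
    intro h h0
    refine hc ?_
    rw [eq_neg_of_add_eq_zero_left h0]
    exact H.neg_mem h.2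
  have hcne := eH_ne_zero hH hc
  have h1 : Multipliable (fun h : H => uu z (c + (h : K))) := by
    refine multipliable_of_tendsto _ ?_
    have h1 : Tendsto (fun h : H => 1 + z * ((h : K) + c)⁻¹) cofinite (𝓝 1) := by
      simpa using ((tendsto_inv hH c).const_mul z).const_add 1
    refine h1.congr fun h => ?_
    rw [uu_ne (hne h), div_eq_mul_inv, add_comm c]
  have h2 := h1.hasProd.mul (eH_hasProd hH c)
  have h3 : (fun h : H => uu z (c + (h : K)) * uu c (h : K)) = fun h : H => uu (z + c) (h : K) := by
    funext h
    rw [uu_ne (hne h), uu, uu]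
    field_simp [hne h]
    ring
  rw [h3] at h2
  have h4 := h2.unique (eH_hasProd hH (z + c))
  have h5 : ∏' h : H, uu z (c + (h : K)) = 1 + eH H z / eH H c := by
    rw [eH_add hH] at h4
    field_simp
    rw [h4]; ring
  rw [← h5]; exact h1.hasProd

lemma eH_sup {H H' : AddSubgroup K} (hH : StronglyDiscrete H) (hH' : StronglyDiscrete H')
    {R : Type*} [Fintype R] [DecidableEq R] (r0 : R) (c : R → K) (hc0 : c r0 = 0)
    (hc : ∀ ρ, ρ ≠ r0 → c ρ ∉ H) (e : R × H ≃ H') (he : ∀ ρ h, (e (ρ, h) : K) = c ρ + h) (z : K) :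
    eH H' z = eH H z * ∏ ρ ∈ Finset.univ.erase r0, (1 + eH H z / eH H (c ρ)) := by
  have h1 : ∀ ρ, HasProd (fun h : H => uu z (e (ρ, h) : K))
      (if ρ = r0 then eH H z else 1 + eH H z / eH H (c ρ)) := by
    intro ρ
    simp only [he]
    split_ifs with h
    · subst h
      simpa [hc0] using eH_hasProd hH z
    · exact eH_coset hH (hc ρ h) z
  have h2 : HasProd (fun x : R × H => uu z (e x : K)) (eH H' z) :=
    (e.hasProd_iff (f := fun h : H' => uu z (h : K))).2 (eH_hasProd hH' z)
  have h3 := h2.prod_fiberwise h1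
  have h4 := h3.unique (hasProd_fintype _)
  rw [h4, ← Finset.mul_prod_erase _ _ (Finset.mem_univ r0), if_pos rfl]
  congr 1
  refine Finset.prod_congr rfl fun ρ hρ => ?_
  rw [if_neg (Finset.ne_of_mem_erase hρ)]

lemma eH_scale {H H' : AddSubgroup K} {a : K} (ha : a ≠ 0) (hHH : ∀ x, x ∈ H' ↔ a * x ∈ H) (z : K) :
    eH H (a * z) = a * eH H' z := by
  unfold eH
  rw [mul_assoc]
  congr 2
  let e : {x : K // x ∈ H' ∧ x ≠ 0} ≃ {x : K // x ∈ H ∧ x ≠ 0} :=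
    { toFun := fun x => ⟨a * x.1, (hHH _).1 x.2.1, mul_ne_zero ha x.2.2⟩
      invFun := fun x => ⟨a⁻¹ * x.1, (hHH _).2 (by rw [mul_inv_cancel_left₀ ha]; exact x.2.1),
        mul_ne_zero (inv_ne_zero ha) x.2.2⟩
      left_inv := fun x => by simp [ha]
      right_inv := fun x => by simp [ha] }
  rw [← e.tprod_eq]
  refine tprod_congr fun x => ?_
  simp only [e, Equiv.coe_fn_mk]
  rw [mul_div_mul_left _ _ ha]

end Aux

section Alg

set_option linter.unusedSectionVars false

open Polynomial

lemma choose_pow_mul {p : ℕ} (hp : p.Prime) (v m : ℕ) :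
    (p ^ v * m).choose (p ^ v) ≡ m [MOD p] := by
  have := Fact.mk hp
  induction v with
  | zero => simp; rfl
  | succ v ih =>
    refine (Choose.choose_modEq_choose_mod_mul_choose_div_nat (p := p)).trans ?_
    have e1 : p ^ (v + 1) * m = p * (p ^ v * m) := by ring
    have e2 : p ^ (v + 1) = p * p ^ v := by ring
    rw [e1, e2]
    simpa [Nat.mul_div_cancel_left _ hp.pos] using ih

lemma eq_pow_of_choose {p : ℕ} (hp : p.Prime) {n : ℕ} (hn : n ≠ 0)
    (h : ∀ j, 0 < j → j < n → p ∣ n.choose j) : ∃ v, n = p ^ v := by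
  obtain ⟨v, m, hm, rfl⟩ := Nat.exists_eq_pow_mul_and_not_dvd hn p hp.ne_one
  refine ⟨v, ?_⟩
  by_contra hne
  have hm0 : m ≠ 0 := by rintro rfl; simp at hm
  have hm1 : m ≠ 1 := by rintro rfl; simp at hne
  have := h (p ^ v) (pow_pos hp.pos _) (lt_mul_of_one_lt_right (pow_pos hp.pos _) (by omega))
  exact hm ((Nat.modEq_zero_iff_dvd).1 ((choose_pow_mul hp v m).symm.trans
    ((Nat.modEq_zero_iff_dvd).2 this)))

variable {K : Type*} [NormedField K]

lemma card_Fq [IsAlgClosed K] {p k q : ℕ} (hp : p.Prime) (hqpk : q = p ^ k) (hk : 0 < k)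
    [CharP K p] (Fq : Subfield K) (hFq : (Fq : Set K) = {x : K | x ^ q = x}) :
    Finite Fq ∧ Nat.card Fq = q := by
  have hq1 : 1 < q := hqpk ▸ Nat.one_lt_pow hk.ne' hp.one_lt
  have hsep : (X ^ q - X : K[X]).Separable :=
    galois_poly_separable p q (hqpk ▸ dvd_pow_self p hk.ne')
  have hdeg : (X ^ q - X : K[X]).natDegree = q := FiniteField.X_pow_card_sub_X_natDegree_eq K hq1
  have hne : (X ^ q - X : K[X]) ≠ 0 := FiniteField.X_pow_card_sub_X_ne_zero K hq1
  have hset : (Fq : Set K) = (X ^ q - X : K[X]).rootSet K := by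
    rw [hFq]; ext x
    rw [mem_rootSet]
    simp [hne, sub_eq_zero]
  have hc := card_rootSet_eq_natDegree (K := K) hsep (IsAlgClosed.splits _)
  rw [hdeg] at hc
  have e : Fq ≃ (X ^ q - X : K[X]).rootSet K := Equiv.setCongr hset
  refine ⟨Finite.of_equiv _ e.symm, ?_⟩
  rw [Nat.card_congr e, Nat.card_eq_fintype_card, hc]

lemma eq_of_eval_infinite {I : Set K} (hI : I.Infinite) {f g : K[X]}
    (h : ∀ x ∈ I, f.eval x = g.eval x) : f = g :=
  Polynomial.eq_of_infinite_eval_eq f g (hI.mono h)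

lemma coeff_of_linear {p k q : ℕ} (hp : p.Prime) (hqpk : q = p ^ k) (hk : 0 < k)
    [CharP K p] (Fq : Subfield K) (hfin : Finite Fq) (hcard : Nat.card Fq = q)
    (hFq : (Fq : Set K) = {x : K | x ^ q = x})
    {I : Set K} (hI : I.Infinite) (f : K[X])
    (hadd : ∀ x ∈ I, ∀ y ∈ I, f.eval (x + y) = f.eval x + f.eval y)
    (hsm : ∀ c ∈ Fq, ∀ x ∈ I, f.eval (c * x) = c * f.eval x)
    (h0 : f.coeff 0 = 0) (n : ℕ) (hn : f.coeff n ≠ 0) : ∃ i, n = q ^ i := by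
  have h1 : ∀ y ∈ I, taylor y f = f + C (f.eval y) := by
    intro y hy
    refine eq_of_eval_infinite hI fun x hx => ?_
    simp [taylor_eval, hadd x hx y hy]
  have h2 : ∀ j, 0 < j → hasseDeriv j f = C (f.coeff j) := by
    intro j hj
    refine eq_of_eval_infinite hI fun y hy => ?_
    rw [← taylor_coeff, h1 y hy, coeff_add, coeff_C_of_ne_zero hj.ne', add_zero, eval_C]
  have hn0 : n ≠ 0 := by rintro rfl; exact hn h0
  obtain ⟨v, hv⟩ : ∃ v, n = p ^ v := by
    refine eq_pow_of_choose hp hn0 fun j hj hjn => ?_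
    have := congrArg (fun g => g.coeff (n - j)) (h2 j hj)
    simp only [hasseDeriv_coeff] at this
    rw [coeff_C_of_ne_zero (by omega), Nat.sub_add_cancel hjn.le] at this
    rw [← CharP.cast_eq_zero_iff K p]
    exact (mul_eq_zero.1 this).resolve_right hn
  have h3 : ∀ c ∈ Fq, c ^ n = c := by
    intro c hc
    have e : f.comp (C c * X) = C c * f := by
      refine eq_of_eval_infinite hI fun y hy => ?_
      simp [hsm c hc y hy]
    have := congrArg (fun g => g.coeff n) e
    simp only [comp_C_mul_X_coeff, coeff_C_mul] at this
    have h' : (c ^ n - c) * f.coeff n = 0 := by linear_combination this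
    exact sub_eq_zero.1 ((mul_eq_zero.1 h').resolve_right hn)
  have hpow : ∀ c ∈ Fq, ∀ s : ℕ, c ^ q ^ s = c := by
    intro c hc s
    have hcq : c ^ q = c := by
      have : c ∈ (Fq : Set K) := hc
      rw [hFq] at this; exact this
    induction s with
    | zero => simp
    | succ s ih => rw [pow_succ, pow_mul, ih, hcq]
  have hnv : n = q ^ (v / k) * p ^ (v % k) := by
    rw [hv, hqpk, ← pow_mul, ← pow_add, Nat.div_add_mod]
  have h4 : ∀ c ∈ Fq, c ^ p ^ (v % k) = c := by
    intro c hc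
    have := h3 c hc
    rwa [hnv, pow_mul, hpow c hc] at this
  rcases Nat.eq_zero_or_pos (v % k) with hu | hu
  · exact ⟨v / k, by rw [hnv, hu]; simp⟩
  exfalso
  have hq1 : 1 < p ^ (v % k) := Nat.one_lt_pow hu.ne' hp.one_lt
  have hlt : p ^ (v % k) < q := hqpk ▸ Nat.pow_lt_pow_right hp.one_lt (Nat.mod_lt _ hk)
  have hdeg := FiniteField.X_pow_card_sub_X_natDegree_eq K hq1
  have hne := FiniteField.X_pow_card_sub_X_ne_zero K hq1
  refine hne (Polynomial.eq_zero_of_natDegree_lt_card_of_eval_eq_zero' _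
    (Set.toFinite (Fq : Set K)).toFinset ?_ ?_)
  · intro c hc
    simp [h4 c (by simpa using hc)]
  · rw [hdeg, ← Set.ncard_eq_toFinset_card (Fq : Set K) (Set.toFinite _)]
    have : (Fq : Set K).ncard = q := by rw [← hcard]; rfl
    omega

variable [IsUltrametricDist K]

lemma norm_Fq {q : ℕ} (hq : 1 < q) (Fq : Subfield K) (hFq : (Fq : Set K) = {x : K | x ^ q = x})
    (c : Fq) (hc : c ≠ 0) : ‖(c : K)‖ = 1 := by
  have hcq : (c : K) ^ q = c := by
    have : (c : K) ∈ (Fq : Set K) := c.2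
    rw [hFq] at this; exact this
  have hc0 : (c : K) ≠ 0 := by simpa using hc
  have h1 : (c : K) ^ (q - 1) = 1 := by
    have : (c : K) ^ (q - 1) * c = 1 * c := by
      rw [← pow_succ, Nat.sub_add_cancel hq.le, hcq, one_mul]
    exact mul_right_cancel₀ hc0 this
  have h2 : ‖(c : K)‖ ^ (q - 1) = 1 := by rw [← norm_pow, h1, norm_one]
  exact (pow_eq_one_iff_of_nonneg (norm_nonneg _) (by omega)).1 h2

lemma norm_aeval_lt {q : ℕ} (hq : 1 < q) (Fq : Subfield K)
    (hFq : (Fq : Set K) = {x : K | x ^ q = x}) (t : K) (ht : ‖t‖ = (q : ℝ)) (n : ℕ)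
    (g : Fq[X]) (hg : g.degree < n) : ‖aeval t g‖ < (q : ℝ) ^ n := by
  have hq' : (1 : ℝ) < q := by exact_mod_cast hq
  rw [aeval_eq_sum_range]
  refine Finset.sum_induction _ (fun x => ‖x‖ < (q : ℝ) ^ n) ?_ ?_ ?_
  · intro a b ha hb
    exact (IsUltrametricDist.norm_add_le_max _ _).trans_lt (max_lt ha hb)
  · simp; positivity
  · intro i hi
    by_cases hc : g.coeff i = 0
    · simp [hc]; positivity
    · have hin : i < n := by
        have := (le_degree_of_ne_zero hc).trans_lt hg
        exact_mod_cast this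
      have : ‖g.coeff i • t ^ i‖ = (q : ℝ) ^ i := by
        rw [Subfield.smul_def, smul_eq_mul, norm_mul, norm_Fq hq Fq hFq _ hc, one_mul, norm_pow, ht]
      rw [this]
      exact pow_lt_pow_right₀ hq' hin

lemma norm_aeval {q : ℕ} (hq : 1 < q) (Fq : Subfield K)
    (hFq : (Fq : Set K) = {x : K | x ^ q = x}) (t : K) (ht : ‖t‖ = (q : ℝ))
    (g : Fq[X]) (hg : g ≠ 0) : ‖aeval t g‖ = (q : ℝ) ^ g.natDegree := by
  have h1 : aeval t g = aeval t g.eraseLead + (g.leadingCoeff : K) * t ^ g.natDegree := by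
    conv_lhs => rw [← g.eraseLead_add_C_mul_X_pow]
    simp only [map_add, map_mul, aeval_C, map_pow, aeval_X]
    rfl
  have h2 : ‖(g.leadingCoeff : K) * t ^ g.natDegree‖ = (q : ℝ) ^ g.natDegree := by
    rw [norm_mul, norm_Fq hq Fq hFq _ (leadingCoeff_ne_zero.2 hg), one_mul, norm_pow, ht]
  have h3 := norm_aeval_lt hq Fq hFq t ht g.natDegree g.eraseLead
    (by rw [← degree_eq_natDegree hg]; exact degree_eraseLead_lt hg)
  rw [h1, IsUltrametricDist.norm_add_eq_max_of_norm_ne_norm (by rw [h2]; exact h3.ne), h2,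
    max_eq_right h3.le]

lemma mem_A_iff (Fq : Subfield K) (t : K) (A : Subring K)
    (hA : A = Subring.closure ((Fq : Set K) ∪ {t})) (a : K) :
    a ∈ A ↔ ∃ f : Fq[X], aeval t f = a := by
  constructor
  · intro h
    have : A ≤ (aeval t : Fq[X] →ₐ[Fq] K).toRingHom.range := by
      rw [hA, Subring.closure_le]
      rintro x (hx | hx)
      · exact ⟨C ⟨x, hx⟩, by simp; rfl⟩
      · rw [Set.mem_singleton_iff] at hx
        exact ⟨X, by simp [hx]⟩
    obtain ⟨f, hf⟩ := this h
    exact ⟨f, hf⟩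
  · rintro ⟨f, rfl⟩
    rw [aeval_eq_sum_range, hA]
    refine sum_mem fun i _ => ?_
    rw [Subfield.smul_def, smul_eq_mul]
    refine mul_mem (Subring.subset_closure (Or.inl (f.coeff i).2))
      (pow_mem (Subring.subset_closure (Set.mem_union_right _ (Set.mem_singleton t))) _)

end Alg

section Main

set_option linter.unusedSectionVars false

open Polynomial

variable {K : Type*} [NormedField K] [CompleteSpace K] [IsUltrametricDist K]

lemma range_infinite {H : AddSubgroup K} (hH : StronglyDiscrete H) (t : K) (ht : 1 < ‖t‖) :
    (Set.range (eH H)).Infinite := by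
  intro hfin
  have hinj : Function.Injective (fun n : ℕ => t⁻¹ ^ n) := by
    intro m n hmn
    have h1 : ‖t⁻¹‖ ^ m = ‖t⁻¹‖ ^ n := by rw [← norm_pow, ← norm_pow]; exact congrArg _ hmn
    have ht0 : 0 < ‖t⁻¹‖ := by rw [norm_inv]; positivity
    have ht1 : ‖t⁻¹‖ < 1 := by rw [norm_inv]; exact inv_lt_one_of_one_lt₀ ht
    exact pow_right_injective₀ ht0 ht1.ne h1
  have hle : ∀ n : ℕ, ‖t⁻¹ ^ n‖ ≤ 1 := by
    intro n
    rw [norm_pow, norm_inv]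
    exact pow_le_one₀ (by positivity) (inv_le_one_of_one_le₀ ht.le)
  have : Finite (Set.range (eH H)) := hfin
  obtain ⟨y, hy⟩ := Finite.exists_infinite_fiber
    (fun n : ℕ => (⟨eH H (t⁻¹ ^ n), Set.mem_range_self _⟩ : Set.range (eH H)))
  rw [Set.infinite_coe_iff] at hy
  obtain ⟨m, hm⟩ := hy.nonempty
  have hsub : (fun n : ℕ => t⁻¹ ^ n - t⁻¹ ^ m) '' ((fun n : ℕ =>
      (⟨eH H (t⁻¹ ^ n), Set.mem_range_self _⟩ : Set.range (eH H))) ⁻¹' {y}) ⊆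
      {z : K | z ∈ H ∧ ‖z‖ ≤ 1} := by
    rintro _ ⟨n, hn, rfl⟩
    refine ⟨?_, ?_⟩
    · by_contra hz
      refine eH_ne_zero hH hz ?_
      change eH H (t⁻¹ ^ n - t⁻¹ ^ m) = 0
      rw [sub_eq_add_neg, eH_add hH, eH_neg hH]
      have e : eH H (t⁻¹ ^ n) = eH H (t⁻¹ ^ m) :=
        congrArg Subtype.val ((hn : _ = y).trans (hm : _ = y).symm)
      rw [e, add_neg_cancel]
    · change ‖t⁻¹ ^ n - t⁻¹ ^ m‖ ≤ 1
      rw [sub_eq_add_neg]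
      refine (IsUltrametricDist.norm_add_le_max _ _).trans (max_le (hle _) ?_)
      rw [norm_neg]; exact hle _
  refine (hy.image ?_).mono hsub (hH 1 one_pos)
  intro i _ j _ hij
  exact hinj (sub_left_injective hij)

lemma natDegree_prod_lin {R : Type*} (S : Finset R) (w : R → K) (hw : ∀ ρ ∈ S, w ρ ≠ 0) :
    (∏ ρ ∈ S, (C (w ρ)⁻¹ * X + 1 : K[X])).natDegree = S.card ∧
    (∏ ρ ∈ S, (C (w ρ)⁻¹ * X + 1 : K[X])) ≠ 0 := by
  have h1 : ∀ ρ ∈ S, (C (w ρ)⁻¹ * X + 1 : K[X]).natDegree = 1 := fun ρ hρ => by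
    rw [← C_1]; exact natDegree_linear (inv_ne_zero (hw ρ hρ))
  have h2 : ∀ ρ ∈ S, (C (w ρ)⁻¹ * X + 1 : K[X]) ≠ 0 := fun ρ hρ h0 => by
    have := h1 ρ hρ
    rw [h0] at this; simp at this
  refine ⟨?_, Finset.prod_ne_zero_iff.2 h2⟩
  rw [natDegree_prod _ _ h2, Finset.sum_congr rfl h1]; simp

lemma exists_poly {q : ℕ} (hq : 1 < q)
    (t : K) (ht : ‖t‖ = (q : ℝ))
    (Fq : Subfield K) (hfin : Finite Fq) (hcard : Nat.card Fq = q)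
    (hFq : (Fq : Set K) = {x : K | x ^ q = x})
    (A : Subring K) (hA : A = Subring.closure ((Fq : Set K) ∪ {t}))
    (H : AddSubgroup K) (hHd : StronglyDiscrete H)
    (hHA : ∀ a ∈ A, ∀ h ∈ H, a * h ∈ H)
    (r : ℕ) (b : Fin r → K) (hbH : ∀ i, b i ∈ H)
    (hspan : ∀ h ∈ H, ∃ c : Fin r → K, (∀ i, c i ∈ A) ∧ h = ∑ i, c i * b i)
    (hindep : ∀ c : Fin r → K, (∀ i, c i ∈ A) → ∑ i, c i * b i = 0 → ∀ i, c i = 0)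
    (f : Fq[X]) (hf : f ≠ 0) :
    ∃ P : K[X], P.natDegree = q ^ (r * f.natDegree) ∧ P.coeff 1 = aeval t f ∧ P.coeff 0 = 0 ∧
      ∀ z, P.eval (eH H z) = eH H (aeval t f * z) := by
  classical
  have mA : ∀ g : Fq[X], aeval t g ∈ A := fun g => (mem_A_iff Fq t A hA _).2 ⟨g, rfl⟩
  have inj0 : ∀ g : Fq[X], aeval t g = 0 → g = 0 := by
    intro g hg
    by_contra hne
    have := norm_aeval hq Fq hFq t ht g hne
    rw [hg, norm_zero] at this
    have : (0 : ℝ) < (q : ℝ) ^ g.natDegree := by positivity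
    linarith
  set a := aeval t f with ha
  have ha0 : a ≠ 0 := fun h => hf (inj0 f h)
  have hspan' : ∀ h ∈ H, ∃ g : Fin r → Fq[X], h = ∑ i, aeval t (g i) * b i := by
    intro h hh
    obtain ⟨c, hc, e⟩ := hspan h hh
    choose g hg using fun i => (mem_A_iff Fq t A hA _).1 (hc i)
    exact ⟨g, by simp only [hg, e]⟩
  have hindep' : ∀ g : Fin r → Fq[X], ∑ i, aeval t (g i) * b i = 0 → ∀ i, g i = 0 :=
    fun g hg i => inj0 _ (hindep (fun i => aeval t (g i)) (fun i => mA _) hg i)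
  have hmemH : ∀ g : Fin r → Fq[X], ∑ i, aeval t (g i) * b i ∈ H := fun g =>
    H.sum_mem fun i _ => hHA _ (mA _) _ (hbH i)
  let H' : AddSubgroup K := H.comap (AddMonoidHom.mulLeft a)
  have memH' : ∀ x, x ∈ H' ↔ a * x ∈ H := fun x => Iff.rfl
  have hH'd : StronglyDiscrete H' := by
    intro ρ hρ
    have := hHd (‖a‖ * ρ) (by positivity)
    refine Set.Finite.of_finite_image (f := fun x => a * x) (this.subset ?_)
      (mul_right_injective₀ ha0).injOn
    rintro _ ⟨x, ⟨hx, hn⟩, rfl⟩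
    refine ⟨hx, ?_⟩
    rw [norm_mul]; gcongr
  set n := f.natDegree with hn
  let R := Fin r → degreeLT Fq n
  have eR : degreeLT Fq n ≃ (Fin n → Fq) := (degreeLTEquiv Fq n).toEquiv
  have : Finite (degreeLT Fq n) := Finite.of_equiv _ eR.symm
  have hRf : Finite R := inferInstanceAs (Finite (Fin r → degreeLT Fq n))
  let _ : Fintype R := Fintype.ofFinite R
  have hRcard : Fintype.card R = q ^ (r * n) := by
    rw [← Nat.card_eq_fintype_card]
    change Nat.card (Fin r → degreeLT Fq n) = _
    rw [Nat.card_fun, Nat.card_congr eR, Nat.card_fun, hcard]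
    simp [← pow_mul, mul_comm]
  let c : R → K := fun ρ => a⁻¹ * ∑ i, aeval t ((ρ i : Fq[X])) * b i
  have hac : ∀ ρ, a * c ρ = ∑ i, aeval t ((ρ i : Fq[X])) * b i := fun ρ =>
    mul_inv_cancel_left₀ ha0 _
  let e0 : R × H → H' := fun x => ⟨c x.1 + x.2, by
    rw [memH', mul_add, hac]
    exact H.add_mem (hmemH _) (hHA _ (mA _) _ x.2.2)⟩
  have he0 : Function.Bijective e0 := by
    constructor
    · rintro ⟨ρ, h⟩ ⟨ρ', h'⟩ heq
      have e1 : c ρ + h = c ρ' + h' := congrArg Subtype.val heq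
      obtain ⟨g, hg⟩ := hspan' _ (H.sub_mem h'.2 h.2)
      have e2 : ∑ i, aeval t ((ρ i : Fq[X]) - (ρ' i : Fq[X]) - f * g i) * b i = 0 := by
        simp only [map_sub, map_mul, sub_mul, Finset.sum_sub_distrib, ← hac, mul_assoc,
          ← Finset.mul_sum, ← hg, ← ha]
        linear_combination a * e1
      have e3 := hindep' _ e2
      have e4 : ρ = ρ' := by
        funext i
        have h5 : (ρ i : Fq[X]) - (ρ' i : Fq[X]) = f * g i := sub_eq_zero.1 (e3 i)
        have h6 : ((ρ i : Fq[X]) - (ρ' i : Fq[X])).degree < f.degree := by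
          rw [degree_eq_natDegree hf]
          exact mem_degreeLT.1 (Submodule.sub_mem _ (ρ i).2 (ρ' i).2)
        have h7 : (ρ i : Fq[X]) - (ρ' i : Fq[X]) = 0 := eq_zero_of_dvd_of_degree_lt ⟨g i, h5⟩ h6
        exact Subtype.ext (sub_eq_zero.1 h7)
      subst e4
      have : h = h' := Subtype.ext (add_left_cancel e1)
      rw [this]
    · rintro ⟨x, hx⟩
      obtain ⟨g, hg⟩ := hspan' _ hx
      refine ⟨(fun i => ⟨g i % f, ?_⟩, ⟨∑ i, aeval t (g i / f) * b i, hmemH _⟩), ?_⟩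
      · rw [mem_degreeLT, hn, ← degree_eq_natDegree hf]
        exact degree_mod_lt _ hf
      · refine Subtype.ext (mul_left_cancel₀ ha0 ?_)
        change a * (c _ + _) = a * x
        rw [mul_add, hac]
        change a * x = _ at hg
        rw [hg]
        simp only [Finset.mul_sum, ← Finset.sum_add_distrib]
        refine Finset.sum_congr rfl fun i _ => ?_
        conv_rhs => rw [← EuclideanDomain.div_add_mod (g i) f]
        rw [map_add, map_mul]
        ring
  have hc0 : c 0 = 0 := by
    change a⁻¹ * ∑ i, aeval t (((0 : degreeLT Fq n) : Fq[X])) * b i = 0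
    simp
  have hc : ∀ ρ, ρ ≠ 0 → c ρ ∉ H := by
    intro ρ hρ hmem
    have : e0 (ρ, 0) = e0 (0, ⟨c ρ, hmem⟩) := Subtype.ext (by simp [e0, hc0])
    exact hρ (congrArg Prod.fst (he0.1 this))
  have key := eH_sup hHd hH'd (0 : R) c hc0 hc (Equiv.ofBijective e0 he0) (fun _ _ => rfl)
  have hw : ∀ ρ ∈ Finset.univ.erase (0 : R), eH H (c ρ) ≠ 0 := fun ρ hρ =>
    eH_ne_zero hHd (hc ρ (Finset.ne_of_mem_erase hρ))
  obtain ⟨d1, d2⟩ := natDegree_prod_lin (Finset.univ.erase (0 : R)) (fun ρ => eH H (c ρ)) hw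
  set Q : K[X] := ∏ ρ ∈ Finset.univ.erase (0 : R), (C (eH H (c ρ))⁻¹ * X + 1 : K[X]) with hQ
  refine ⟨C a * (Q * X), ?_, ?_, ?_, ?_⟩
  · rw [natDegree_C_mul ha0, natDegree_mul_X d2, d1, Finset.card_erase_of_mem (Finset.mem_univ _),
      Finset.card_univ, hRcard]
    exact Nat.sub_add_cancel (Nat.one_le_pow _ _ (by omega))
  · rw [coeff_C_mul, coeff_mul_X, coeff_zero_eq_eval_zero, hQ, eval_prod]
    simp
  · simp
  · intro z
    rw [eH_scale ha0 memH', key]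
    simp only [eval_mul, eval_C, eval_X, hQ, eval_prod, eval_add, eval_one]
    rw [mul_comm (eH H z)]
    congr 2
    refine Finset.prod_congr rfl fun ρ _ => ?_
    rw [div_eq_mul_inv]; ring

end Main

/-- Here `K` plays the role of `C_∞`, the completion of an algebraic
closure of `F_∞ = 𝔽_q((1/t))`; the subring `A ⊂ K` is `𝔽_q[t]`, pinned down as the subring
generated by `𝔽_q = {x : K | x ^ q = x}` and `t`, where `‖t‖ = q`.  Let `H ⊂ K` be an
`A`-lattice of rank `r`, i.e. a strongly discrete `A`-submodule of `K`, free of rank `r`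
over `A` (with basis `b`).  Then for every nonzero `a ∈ A` of degree `d` (i.e. `‖a‖ = q^d`)
there is a unique `𝔽_q`-linear polynomial `φ^H_a(X) = ∑ c_i X^{q^i}` of degree
`q^{r·d} = |a|^r` with `φ^H_a(e_H(z)) = e_H(az)` for all `z`; moreover its coefficient of
`X = X^{q^0}` is `a`, and `a ↦ φ^H_a` is additive and multiplicative (a Drinfeld `A`-module
of rank `r`). -/
theorem statement3 (p k q : ℕ) (hp : p.Prime) (hqpk : q = p ^ k) (hk : 0 < k)
    {K : Type*} [NormedField K] [CompleteSpace K] [IsAlgClosed K] [IsUltrametricDist K]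
    [CharP K p]
    (t : K) (ht : ‖t‖ = (q : ℝ))
    (Fq : Subfield K) (hFq : (Fq : Set K) = {x : K | x ^ q = x})
    (A : Subring K) (hA : A = Subring.closure ((Fq : Set K) ∪ {t}))
    (H : AddSubgroup K) (hHd : StronglyDiscrete H)
    (hHA : ∀ a ∈ A, ∀ h ∈ H, a * h ∈ H)
    (r : ℕ) (hr : 0 < r)
    (b : Fin r → K) (hbH : ∀ i, b i ∈ H)
    (hspan : ∀ h ∈ H, ∃ c : Fin r → K, (∀ i, c i ∈ A) ∧ h = ∑ i, c i * b i)
    (hindep : ∀ c : Fin r → K, (∀ i, c i ∈ A) → ∑ i, c i * b i = 0 → ∀ i, c i = 0) :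
    ∃ Φ : K → Polynomial K,
      (∀ a : K, a ∈ A → a ≠ 0 → ∀ d : ℕ, ‖a‖ = (q : ℝ) ^ d →
        ((∀ n : ℕ, (Φ a).coeff n ≠ 0 → ∃ i : ℕ, n = q ^ i) ∧
          (Φ a).natDegree = q ^ (r * d) ∧
          (Φ a).coeff 1 = a ∧
          (∀ z : K, (Φ a).eval (eH H z) = eH H (a * z)) ∧
          (∀ ψ : Polynomial K, (∀ n : ℕ, ψ.coeff n ≠ 0 → ∃ i : ℕ, n = q ^ i) →
            ψ.natDegree = q ^ (r * d) → (∀ z : K, ψ.eval (eH H z) = eH H (a * z)) →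
            ψ = Φ a))) ∧
      (∀ a b' : K, a ∈ A → b' ∈ A → a ≠ 0 → b' ≠ 0 → Φ (a + b') = Φ a + Φ b') ∧
      (∀ a b' : K, a ∈ A → b' ∈ A → a ≠ 0 → b' ≠ 0 → Φ (a * b') = (Φ a).comp (Φ b')) := by
  classical
  have hq1 : 1 < q := hqpk ▸ Nat.one_lt_pow hk.ne' hp.one_lt
  have hq1' : (1 : ℝ) < q := by exact_mod_cast hq1
  obtain ⟨hfin, hcard⟩ := card_Fq hp hqpk hk Fq hFq
  have hI := range_infinite hHd t (ht ▸ hq1')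
  have huniq : ∀ P Q : Polynomial K, (∀ z, P.eval (eH H z) = Q.eval (eH H z)) → P = Q := by
    intro P Q h
    refine eq_of_eval_infinite hI ?_
    rintro _ ⟨z, rfl⟩
    exact h z
  have hsm : ∀ c ∈ Fq, ∀ z, eH H (c * z) = c * eH H z := by
    intro c hc z
    by_cases h0 : c = 0
    · simp [h0, eH_zero]
    have hcA : ∀ c ∈ Fq, c ∈ A := fun c hc => by
      rw [hA]; exact Subring.subset_closure (Or.inl hc)
    refine eH_scale h0 (fun x => ⟨hHA c (hcA c hc) x, fun hx => ?_⟩) z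
    have := hHA _ (hcA _ (Fq.inv_mem hc)) _ hx
    rwa [inv_mul_cancel_left₀ h0] at this
  have hex : ∀ a ∈ A, a ≠ 0 → ∀ z : K, ∃ P : Polynomial K, ∃ d : ℕ, ‖a‖ = (q : ℝ) ^ d ∧
      P.natDegree = q ^ (r * d) ∧ P.coeff 1 = a ∧ P.coeff 0 = 0 ∧
      ∀ z, P.eval (eH H z) = eH H (a * z) := by
    intro a ha ha0 _
    obtain ⟨f, rfl⟩ := (mem_A_iff Fq t A hA a).1 ha
    have hf : f ≠ 0 := by rintro rfl; simp at ha0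
    obtain ⟨P, h1, h2, h3, h4⟩ := exists_poly hq1 t ht Fq hfin hcard hFq A hA H hHd hHA r b hbH
      hspan hindep f hf
    exact ⟨P, f.natDegree, norm_aeval hq1 Fq hFq t ht f hf, h1, h2, h3, h4⟩
  let Φ : K → Polynomial K := fun a =>
    if h : ∃ P : Polynomial K, ∀ z, P.eval (eH H z) = eH H (a * z) then h.choose else 0
  have hΦ : ∀ a (P : Polynomial K), (∀ z, P.eval (eH H z) = eH H (a * z)) → P = Φ a := by
    intro a P hP
    have h : ∃ P : Polynomial K, ∀ z, P.eval (eH H z) = eH H (a * z) := ⟨P, hP⟩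
    have e : Φ a = h.choose := dif_pos h
    refine huniq _ _ fun z => ?_
    rw [hP, e, h.choose_spec]
  have hΦe : ∀ a ∈ A, a ≠ 0 → ∀ z, (Φ a).eval (eH H z) = eH H (a * z) := by
    intro a ha ha0
    obtain ⟨P, d, -, -, -, -, hP⟩ := hex a ha ha0 0
    rw [← hΦ a P hP]; exact hP
  refine ⟨Φ, ?_, ?_, ?_⟩
  · intro a ha ha0 d hd
    obtain ⟨P, d', hd', h1, h2, h3, hP⟩ := hex a ha ha0 0
    have hdd : d' = d := pow_right_injective₀ (by positivity) hq1'.ne' (hd'.symm.trans hd)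
    subst hdd
    have e := hΦ a P hP
    rw [← e]
    refine ⟨?_, h1, h2, hP, fun ψ _ _ hψ => (hΦ a ψ hψ).trans e.symm⟩
    refine coeff_of_linear hp hqpk hk Fq hfin hcard hFq hI P ?_ ?_ h3
    · rintro _ ⟨x, rfl⟩ _ ⟨y, rfl⟩
      rw [← eH_add hHd, hP, hP, hP, mul_add, eH_add hHd]
    · rintro c hc _ ⟨x, rfl⟩
      rw [← hsm c hc, hP, hP, ← hsm c hc]
      congr 1; ring
  · intro a b' ha hb ha0 hb0
    refine (hΦ _ _ fun z => ?_).symm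
    rw [Polynomial.eval_add, hΦe a ha ha0, hΦe b' hb hb0, ← eH_add hHd, add_mul]
  · intro a b' ha hb ha0 hb0
    refine (hΦ _ _ fun z => ?_).symm
    rw [Polynomial.eval_comp, hΦe b' hb hb0, hΦe a ha ha0, mul_assoc]

end Paper
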